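/- arXiv:math/0703578 — 2 statements merged into one kernel-verified Lean document; each statement's English description precedes it below -/
import Mathlib

section
/- The elliptic curve E : Y² = X³ + A·X + B (with A, B ∈ ℤ and 4A³ + 27B² ≠ 0) has a rational point of order 5 if and only if there exist integers z₁, z₂, z₃ such that 2A = (z₁ − z₂)² − 6z₁² + (z₁ − z₂)z₃², 4B = (z₁ + z₂)·(6z₁² − 2z₁z₂ + (z₂ − z₁)z₃²), and z₃⁴ − 6z₃²(z₁ + z₂) + (z₁ − z₂)² = 0. -/
/-- The elliptic curve `E : Y² = X³ + A·X + B` over `ℚ`, as an affine Weierstrass curve. -/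
noncomputable def E (A B : ℤ) : WeierstrassCurve.Affine ℚ :=
  { a₁ := 0, a₂ := 0, a₃ := 0, a₄ := (A : ℚ), a₆ := (B : ℚ) }

theorem Rat.isInt_of_sq_eq_int {r : ℚ} {n : ℤ} (h : r ^ 2 = n) : ∃ k : ℤ, r = k := by
  obtain ⟨k, hk⟩ := IsIntegrallyClosed.exists_algebraMap_eq_of_isIntegral_pow (R := ℤ) (K := ℚ)
    (x := r) (n := 2) (by norm_num) (by rw [h]; exact isIntegral_algebraMap (x := n))
  exact ⟨k, by simpa using hk.symm⟩

/-- A rational point on `Y² = X³ + A·X + B` whose abscissa is a root of the fifth division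
polynomial has integral abscissa. -/
theorem isInt_of_divisionPolynomial_five_eq_zero {A B : ℤ} {x y : ℚ}
    (h : y ^ 2 = x ^ 3 + A * x + B)
    (hψ : 32 * (x ^ 3 + A * x + B) ^ 2 * (x ^ 6 + 5 * A * x ^ 4 + 20 * B * x ^ 3 - 5 * A ^ 2 * x ^ 2
      - 4 * A * B * x - 8 * B ^ 2 - A ^ 3) = (3 * x ^ 4 + 6 * A * x ^ 2 + 12 * B * x - A ^ 2) ^ 3) :
    ∃ z : ℤ, x = z := by
  obtain ⟨a, q, hq, hx, hcop⟩ : ∃ a q : ℤ, 0 < q ∧ x = a / q ∧ IsCoprime q a :=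
    ⟨x.num, x.den, by exact_mod_cast x.pos, by exact_mod_cast (Rat.num_div_den x).symm,
      (Int.isCoprime_iff_gcd_eq_one.2 (by simpa [Int.gcd] using x.reduced)).symm⟩
  have hq' : (q : ℚ) ≠ 0 := by exact_mod_cast hq.ne'
  have key : q ∣ 5 * a ^ 12 := by
    refine ⟨-(62 * A * a ^ 10 * q + 380 * B * a ^ 9 * q ^ 2 - 105 * A ^ 2 * a ^ 8 * q ^ 3
      + 240 * A * B * a ^ 7 * q ^ 4 - (300 * A ^ 3 + 240 * B ^ 2) * a ^ 6 * q ^ 5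
      - 696 * A ^ 2 * B * a ^ 5 * q ^ 6 - (125 * A ^ 4 + 1920 * A * B ^ 2) * a ^ 4 * q ^ 7
      - (80 * A ^ 3 * B + 1600 * B ^ 3) * a ^ 3 * q ^ 8
      - (50 * A ^ 5 + 240 * A ^ 2 * B ^ 2) * a ^ 2 * q ^ 9
      - (100 * A ^ 4 * B + 640 * A * B ^ 3) * a * q ^ 10
      + (A ^ 6 - 32 * A ^ 3 * B ^ 2 - 256 * B ^ 4) * q ^ 11), ?_⟩
    rw [hx] at hψ
    field_simp at hψ
    qify
    linear_combination hψ
  have h5 : q ∣ 5 := hcop.pow_right.dvd_of_dvd_mul_right key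
  have hq5 : q = 1 ∨ q = 5 := by
    have := Int.le_of_dvd (by norm_num) h5
    interval_cases q <;> omega
  rcases hq5 with rfl | rfl
  · exact ⟨a, by simp [hx]⟩
  · exfalso
    obtain ⟨w, hw⟩ := Rat.isInt_of_sq_eq_int (r := 25 * y)
      (n := 5 * (a ^ 3 + 25 * A * a + 125 * B)) (by
        push_cast
        rw [mul_pow, h, hx]
        push_cast
        ring)
    have hw2 : w ^ 2 = 5 * (a ^ 3 + 25 * A * a + 125 * B) := by
      qify
      rw [← hw, mul_pow, h, hx]
      push_cast
      ring
    have hp : Prime (5 : ℤ) := by norm_num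
    obtain ⟨v, rfl⟩ := hp.dvd_of_dvd_pow (Dvd.intro _ hw2.symm)
    have ha : (5 : ℤ) ∣ a :=
      hp.dvd_of_dvd_pow (n := 3) ⟨v ^ 2 - 5 * A * a - 25 * B, by linarith⟩
    exact hp.not_isUnit (hcop.isUnit_of_dvd' dvd_rfl ha)

/-- If the tangent lines at `P = (x₁, y₁)` and `Q = (x₂, y₂)` have slopes `m` and `n`, and
`Q = 2P`, `-P = 2Q`, then `x₁` is integral. -/
theorem isInt_of_tangent_cycle {A B : ℤ} {x₁ y₁ x₂ y₂ m n : ℚ}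
    (h₁ : y₁ ^ 2 = x₁ ^ 3 + A * x₁ + B) (hm : 2 * y₁ * m = 3 * x₁ ^ 2 + A)
    (hx₂ : x₂ = m ^ 2 - 2 * x₁) (hx₁ : x₁ = n ^ 2 - 2 * x₂)
    (hy₂ : y₂ = m * (x₁ - x₂) - y₁) (hy₁ : -y₁ = n * (x₂ - x₁) - y₂) :
    ∃ z : ℤ, x₁ = z := by
  refine isInt_of_divisionPolynomial_five_eq_zero h₁ ?_
  have e₁ : x₁ = (2 * m ^ 2 - n ^ 2) / 3 := by linarith
  have e₂ : x₂ = (2 * n ^ 2 - m ^ 2) / 3 := by linarith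
  have e₃ : y₁ = (m + n) * (x₁ - x₂) / 2 := by linarith
  have hA : (A : ℚ) = 2 * y₁ * m - 3 * x₁ ^ 2 := by linarith
  have hB : (B : ℚ) = y₁ ^ 2 - x₁ ^ 3 - A * x₁ := by linarith
  rw [hB, hA, e₃, e₂, e₁]
  ring

namespace E

open WeierstrassCurve.Affine

variable {A B : ℤ}

theorem nonsingular_iff {x y : ℚ} : (E A B).Nonsingular x y ↔
    y ^ 2 = x ^ 3 + A * x + B ∧ (0 ≠ 3 * x ^ 2 + A ∨ y ≠ -y) := by
  simp [WeierstrassCurve.Affine.nonsingular_iff, equation_iff, E]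

theorem negY_eq (x y : ℚ) : (E A B).negY x y = -y := by
  simp [negY, E]

theorem Y_ne_zero_of_add_self_ne_zero {x y : ℚ} {h : (E A B).Nonsingular x y}
    (h₀ : Point.some x y h + Point.some x y h ≠ 0) : y ≠ 0 := by
  rintro rfl
  exact h₀ (Point.add_self_of_Y_eq (by rw [negY_eq, neg_zero]))

theorem add_self_eq {x y m x' y' : ℚ} {h : (E A B).Nonsingular x y} (hy : y ≠ 0)
    (hm : 2 * y * m = 3 * x ^ 2 + A) (hx' : x' = m ^ 2 - 2 * x) (hy' : y' = m * (x - x') - y) :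
    ∃ h' : (E A B).Nonsingular x' y',
      Point.some x y h + Point.some x y h = Point.some x' y' h' := by
  have hne : y ≠ (E A B).negY x y := by
    rw [negY_eq]
    intro h
    exact hy (by linarith)
  have hs : (E A B).slope x x y y = m := by
    rw [slope_of_Y_ne rfl hne, negY_eq]
    simp only [E]
    rw [div_eq_iff (by ring_nf; simpa using hy)]
    linear_combination -hm
  have ex : (E A B).addX x x m = x' := by
    simp only [addX, E, hx']
    ring
  have ey : (E A B).addY x x y m = y' := by
    rw [addY, negY_eq, negAddY, ex, hy']
    ring
  have := Point.add_self_of_Y_ne (h₁ := h) hne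
  subst ex ey hs
  exact ⟨_, this⟩

end E

theorem order_five_iff (A B : ℤ) (hΔ : 4 * A ^ 3 + 27 * B ^ 2 ≠ 0) :
    (∃ P : (E A B).Point, addOrderOf P = 5) ↔
      ∃ z₁ z₂ z₃ : ℤ,
        2 * A = (z₁ - z₂) ^ 2 - 6 * z₁ ^ 2 + (z₁ - z₂) * z₃ ^ 2 ∧
        4 * B = (z₁ + z₂) * (6 * z₁ ^ 2 - 2 * z₁ * z₂ + (z₂ - z₁) * z₃ ^ 2) ∧
        z₃ ^ 4 - 6 * z₃ ^ 2 * (z₁ + z₂) + (z₁ - z₂) ^ 2 = 0 := by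
  constructor
  · rintro ⟨P, hP⟩
    have hk : ∀ k : ℕ, 0 < k → k < 5 → k • P ≠ 0 := fun k h0 h5 h ↦
      absurd (Nat.le_of_dvd h0 (addOrderOf_dvd_of_nsmul_eq_zero h)) (by omega)
    have h5 : 5 • P = 0 := hP ▸ addOrderOf_nsmul_eq_zero P
    rcases P with _ | ⟨x₁, y₁, h₁⟩
    · exact absurd rfl (hk 1 one_pos (by norm_num))
    set P := WeierstrassCurve.Affine.Point.some x₁ y₁ h₁ with hPdef
    have hy₁ : y₁ ≠ 0 := E.Y_ne_zero_of_add_self_ne_zero (h := h₁) (by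
      rw [← hPdef, ← two_nsmul]
      exact hk 2 (by norm_num) (by norm_num))
    obtain ⟨m, hm⟩ : ∃ m : ℚ, 2 * y₁ * m = 3 * x₁ ^ 2 + A :=
      ⟨(3 * x₁ ^ 2 + A) / (2 * y₁), by field_simp⟩
    obtain ⟨x₂, hx₂⟩ : ∃ x₂, x₂ = m ^ 2 - 2 * x₁ := ⟨_, rfl⟩
    obtain ⟨y₂, hy₂⟩ : ∃ y₂, y₂ = m * (x₁ - x₂) - y₁ := ⟨_, rfl⟩
    obtain ⟨h₂, hQ⟩ := E.add_self_eq (h := h₁) hy₁ hm hx₂ hy₂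
    rw [← hPdef] at hQ
    set Q := WeierstrassCurve.Affine.Point.some x₂ y₂ h₂ with hQdef
    have hy₂0 : y₂ ≠ 0 := E.Y_ne_zero_of_add_self_ne_zero (h := h₂) (by
      rw [← hQdef, ← hQ, show P + P + (P + P) = 4 • P by abel]
      exact hk 4 (by norm_num) (by norm_num))
    obtain ⟨n, hn⟩ : ∃ n : ℚ, 2 * y₂ * n = 3 * x₂ ^ 2 + A :=
      ⟨(3 * x₂ ^ 2 + A) / (2 * y₂), by field_simp⟩
    obtain ⟨h₃, hR⟩ := E.add_self_eq (h := h₂) hy₂0 hn rfl rfl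
    have hneg : Q + Q = -P := by
      rw [eq_neg_iff_add_eq_zero, ← hQ, ← h5]
      abel
    rw [← hQdef, hneg, hPdef, WeierstrassCurve.Affine.Point.neg_some,
      WeierstrassCurve.Affine.Point.some.injEq, E.negY_eq] at hR
    obtain ⟨hx₁, hy₁'⟩ := hR
    rw [← hx₁] at hy₁'
    have e₁ := (E.nonsingular_iff.1 h₁).1
    have e₂ := (E.nonsingular_iff.1 h₂).1
    obtain ⟨z₁, hz₁⟩ := isInt_of_tangent_cycle e₁ hm hx₂ hx₁ hy₂ hy₁'
    obtain ⟨z₂, hz₂⟩ := isInt_of_tangent_cycle (y₂ := -y₁) (n := -m) e₂ hn hx₁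
      (by linarith) hy₁' (by linarith)
    obtain ⟨k, hk⟩ := Rat.isInt_of_sq_eq_int (r := m) (n := 2 * z₁ + z₂) (by
      push_cast; linarith)
    obtain ⟨l, hl⟩ := Rat.isInt_of_sq_eq_int (r := n) (n := 2 * z₂ + z₁) (by
      push_cast; linarith)
    refine ⟨z₁, z₂, k + l, ?_⟩
    qify
    rw [← hz₁, ← hz₂, ← hk, ← hl]
    have f₁ : x₁ = (2 * m ^ 2 - n ^ 2) / 3 := by linarith
    have f₂ : x₂ = (2 * n ^ 2 - m ^ 2) / 3 := by linarith
    have f₃ : y₁ = (m + n) * (x₁ - x₂) / 2 := by linarith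
    have hA : (A : ℚ) = 2 * y₁ * m - 3 * x₁ ^ 2 := by linarith
    have hB : (B : ℚ) = y₁ ^ 2 - x₁ ^ 3 - A * x₁ := by linarith
    rw [hB, hA, f₃, f₂, f₁]
    refine ⟨?_, ?_, ?_⟩ <;> ring
  · rintro ⟨z₁, z₂, z₃, hA, hB, h⟩
    have hΔ' : ¬(A = -3 * z₁ ^ 2 ∧ B = 2 * z₁ ^ 3) := by
      rintro ⟨rfl, rfl⟩
      exact hΔ (by ring)
    have h12 : z₁ ≠ z₂ := by
      rintro rfl
      exact hΔ' ⟨by linarith, by linarith⟩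
    have h3 : z₃ ≠ 0 := by
      rintro rfl
      exact h12 (sub_eq_zero.1 (pow_eq_zero_iff two_ne_zero |>.1 (by linarith)))
    have h12' : (z₁ - z₂ : ℚ) ≠ 0 := sub_ne_zero.2 (by exact_mod_cast h12)
    have h3' : (z₃ : ℚ) ≠ 0 := by exact_mod_cast h3
    qify at hA hB h
    generalize (z₁ : ℚ) = x₁ at *
    generalize (z₂ : ℚ) = x₂ at *
    generalize (z₃ : ℚ) = t at *
    have hy₁ : t * (x₁ - x₂) / 2 ≠ 0 := by positivity
    have hy₂ : (x₁ - x₂) ^ 2 / (2 * t) ≠ 0 := by positivity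
    have h₁ : (E A B).Nonsingular x₁ (t * (x₁ - x₂) / 2) := by
      refine E.nonsingular_iff.2 ⟨?_, .inr fun h ↦ hy₁ (by linarith)⟩
      linear_combination -x₁ / 2 * hA - hB / 4
    obtain ⟨h₂, hQ⟩ := E.add_self_eq (h := h₁) (m := (t ^ 2 + x₁ - x₂) / (2 * t)) (x' := x₂)
      (y' := (x₁ - x₂) ^ 2 / (2 * t)) hy₁
      (by field_simp; linear_combination -hA)
      (by field_simp; linear_combination -h)
      (by field_simp; ring)
    obtain ⟨h₃, hR⟩ := E.add_self_eq (h := h₂) (m := (t ^ 2 - x₁ + x₂) / (2 * t)) (x' := x₁)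
      (y' := -(t * (x₁ - x₂) / 2)) hy₂
      (by field_simp; linear_combination -t ^ 2 * hA - (x₁ - x₂) * h)
      (by field_simp; linear_combination -h)
      (by field_simp; ring)
    refine ⟨.some _ _ h₁, ?_⟩
    have : Fact (Nat.Prime 5) := ⟨by norm_num⟩
    refine addOrderOf_eq_prime ?_ (WeierstrassCurve.Affine.Point.some_ne_zero h₁)
    have hneg : WeierstrassCurve.Affine.Point.some _ _ h₃ = -.some _ _ h₁ := by
      simp only [WeierstrassCurve.Affine.Point.neg_some, E.negY_eq]
    rw [← hQ, hneg] at hR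
    rw [← neg_add_cancel (WeierstrassCurve.Affine.Point.some _ _ h₁), ← hR]
    abel
end

section
/- The elliptic curve E : Y² = X³ + A·X + B (with A, B ∈ ℤ and 4A³ + 27B² ≠ 0) has a rational point of order 9 if and only if there exist integers z₁, z₂, z₃ such that, setting w = 9z₁³ + z₂, one has A = 27z₁⁴ + 6z₁z₂, B = z₂² − 27z₁⁶, and z₃⁹ − 72z₁·w·z₃⁷ − 48(27z₁³ + 2z₂)·w·z₃⁶ − 864z₁²·w²·z₃⁵ − 144z₁·w³·z₃⁴ + 48(45z₁³ + z₂)·w³·z₃³ + 1728z₁²·w⁴·z₃² + 576z₁·w⁵·z₃ + 64w⁶ = 0. -/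
namespace OrderNine

open WeierstrassCurve.Affine

/-- The degree-nine polynomial whose integral roots detect a point of order nine. -/
def divisionPolynomial {R : Type*} [CommRing R] (z₁ z₂ z₃ : R) : R :=
  z₃ ^ 9 - 72 * z₁ * (9 * z₁ ^ 3 + z₂) * z₃ ^ 7
    - 48 * (27 * z₁ ^ 3 + 2 * z₂) * (9 * z₁ ^ 3 + z₂) * z₃ ^ 6
    - 864 * z₁ ^ 2 * (9 * z₁ ^ 3 + z₂) ^ 2 * z₃ ^ 5
    - 144 * z₁ * (9 * z₁ ^ 3 + z₂) ^ 3 * z₃ ^ 4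
    + 48 * (45 * z₁ ^ 3 + z₂) * (9 * z₁ ^ 3 + z₂) ^ 3 * z₃ ^ 3
    + 1728 * z₁ ^ 2 * (9 * z₁ ^ 3 + z₂) ^ 4 * z₃ ^ 2
    + 576 * z₁ * (9 * z₁ ^ 3 + z₂) ^ 5 * z₃
    + 64 * (9 * z₁ ^ 3 + z₂) ^ 6

/-- Writing `f` and `k` for the cubic and its derivative at `u + 3 * z₁ ^ 2`, the norm of the
relation `x(P - Q) = x(2Q)` is the division polynomial times `u ^ 3`. -/
lemma norm_eq {R : Type*} [CommRing R] {z₁ z₂ u f k : R}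
    (hf : f = (u + 3 * z₁ ^ 2) ^ 3 + (27 * z₁ ^ 4 + 6 * z₁ * z₂) * (u + 3 * z₁ ^ 2)
      + (z₂ ^ 2 - 27 * z₁ ^ 6))
    (hk : k = 3 * (u + 3 * z₁ ^ 2) ^ 2 + (27 * z₁ ^ 4 + 6 * z₁ * z₂)) :
    (k ^ 2 * u ^ 2 - 4 * f * (f + (9 * z₁ ^ 3 + z₂) ^ 2 + u ^ 3)) ^ 2
      - 64 * (9 * z₁ ^ 3 + z₂) ^ 2 * f ^ 3 = divisionPolynomial z₁ z₂ u * u ^ 3 := by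
  subst hf hk
  unfold divisionPolynomial
  ring

lemma exists_intCast_of_monic {p : Polynomial ℤ} (hp : p.Monic) {r : ℚ}
    (hr : Polynomial.aeval r p = 0) : ∃ n : ℤ, (n : ℚ) = r :=
  isInteger_of_is_root_of_monic hp hr

lemma exists_intCast_of_sq {r : ℚ} {c : ℤ} (hr : r ^ 2 = c) : ∃ n : ℤ, (n : ℚ) = r := by
  refine exists_intCast_of_monic (p := Polynomial.X ^ 2 - Polynomial.C c) (by monicity!) ?_
  simp [hr]

lemma exists_intCast_of_divisionPolynomial {z₁ z₂ : ℤ} {r : ℚ}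
    (hr : divisionPolynomial (z₁ : ℚ) z₂ r = 0) : ∃ n : ℤ, (n : ℚ) = r := by
  refine exists_intCast_of_monic
    (p := divisionPolynomial (Polynomial.C z₁) (Polynomial.C z₂) Polynomial.X) ?_ ?_
  · unfold divisionPolynomial
    monicity!
  · simpa [divisionPolynomial, map_ofNat] using hr

variable {A B : ℤ}

lemma nonsingular_E_iff (hΔ : 4 * A ^ 3 + 27 * B ^ 2 ≠ 0) (x y : ℚ) :
    (E A B).Nonsingular x y ↔ y ^ 2 = x ^ 3 + A * x + B := by
  have h : (E A B).Δ ≠ 0 := by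
    have : (4 * A ^ 3 + 27 * B ^ 2 : ℚ) ≠ 0 := mod_cast hΔ
    have h' : (E A B).Δ = -16 * (4 * A ^ 3 + 27 * B ^ 2 : ℚ) := by
      simp [E, WeierstrassCurve.Δ, WeierstrassCurve.b₂, WeierstrassCurve.b₄,
        WeierstrassCurve.b₆, WeierstrassCurve.b₈]
      ring
    rw [h']
    exact mul_ne_zero (by norm_num) this
  rw [← equation_iff_nonsingular_of_Δ_ne_zero h, equation_iff]
  simp [E]

lemma equation_of_nonsingular {x y : ℚ} (h : (E A B).Nonsingular x y) :
    y ^ 2 = x ^ 3 + A * x + B := by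
  simpa [E] using (equation_iff x y).mp h.1

lemma add_self_eq {x y : ℚ} (h : (E A B).Nonsingular x y) (hy : y ≠ 0) :
    ∃ y' h', Point.some x y h + Point.some x y h =
      Point.some (((3 * x ^ 2 + A) / (2 * y)) ^ 2 - 2 * x) y' h' := by
  have hne : y ≠ (E A B).negY x y := by
    simp only [E, negY]
    intro h0
    apply hy
    linarith
  have hX : (E A B).addX x x ((E A B).slope x x y y) =
      ((3 * x ^ 2 + A) / (2 * y)) ^ 2 - 2 * x := by
    rw [slope_of_Y_ne rfl hne]
    simp only [E, negY, addX]
    ring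
  rw [Point.add_self_of_Y_ne hne, ← hX]
  exact ⟨_, _, rfl⟩

lemma sub_eq {x₀ y₀ x y : ℚ} (h₀ : (E A B).Nonsingular x₀ y₀) (h : (E A B).Nonsingular x y)
    (hx : x₀ ≠ x) : ∃ y' h', Point.some x₀ y₀ h₀ - Point.some x y h =
      Point.some (((y₀ + y) / (x₀ - x)) ^ 2 - x₀ - x) y' h' := by
  have hX : (E A B).addX x₀ x ((E A B).slope x₀ x y₀ ((E A B).negY x y)) =
      ((y₀ + y) / (x₀ - x)) ^ 2 - x₀ - x := by
    rw [slope_of_X_ne hx]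
    simp only [E, negY, addX]
    ring
  rw [sub_eq_add_neg (Point.some ..), Point.neg_some, Point.add_of_X_ne hx, ← hX]
  exact ⟨_, _, rfl⟩

lemma add_self_eq_zero {x y : ℚ} (h : (E A B).Nonsingular x y) (hy : y = 0) :
    Point.some x y h + Point.some x y h = 0 :=
  Point.add_self_of_Y_eq (by simp [E, negY, hy])

lemma three_nsmul_eq_zero_iff {x y : ℚ} (h : (E A B).Nonsingular x y) (hy : y ≠ 0) :
    3 • Point.some x y h = 0 ↔ ((3 * x ^ 2 + A) / (2 * y)) ^ 2 = 3 * x := by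
  obtain ⟨y', h', e⟩ := add_self_eq h hy
  have hP : Point.some x y h ≠ 0 := Point.some_ne_zero h
  have hiff : 3 • Point.some x y h = 0 ↔ ((3 * x ^ 2 + A) / (2 * y)) ^ 2 - 2 * x = x := by
    rw [Point.X_eq_iff (h₁ := h') (h₂ := h), ← e, add_eq_left, or_iff_right hP,
      eq_neg_iff_add_eq_zero]
    congr! 1
    abel
  rw [hiff]
  constructor <;> intro <;> linarith

lemma three_nsmul_eq_iff {x₀ y₀ x y : ℚ} (h₀ : (E A B).Nonsingular x₀ y₀)
    (h : (E A B).Nonsingular x y) (hx : x₀ ≠ x) (hy : y ≠ 0) :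
    3 • Point.some x y h = Point.some x₀ y₀ h₀ ↔
      (3 * x ^ 2 + A) ^ 2 * (x - x₀) ^ 2 - 4 * y ^ 2 * (y ^ 2 + y₀ ^ 2 + (x - x₀) ^ 3)
        = 8 * y₀ * y ^ 3 := by
  have hu : x₀ - x ≠ 0 := sub_ne_zero.mpr hx
  have hclear : ((y₀ + y) / (x₀ - x)) ^ 2 - x₀ - x = ((3 * x ^ 2 + A) / (2 * y)) ^ 2 - 2 * x ↔
      (3 * x ^ 2 + A) ^ 2 * (x - x₀) ^ 2 - 4 * y ^ 2 * (y ^ 2 + y₀ ^ 2 + (x - x₀) ^ 3)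
        = 8 * y₀ * y ^ 3 := by
    field_simp
    constructor <;> intro e <;> linear_combination -e
  obtain ⟨y₁, h₁, e₁⟩ := add_self_eq h hy
  obtain ⟨y₂, h₂, e₂⟩ := sub_eq h₀ h hx
  have hne : Point.some x₀ y₀ h₀ ≠ -Point.some x y h := fun e =>
    hx (Point.X_eq_iff (h₁ := h₀) (h₂ := h) |>.mpr (Or.inr e))
  rw [← hclear, Point.X_eq_iff (h₁ := h₂) (h₂ := h₁), ← e₁, ← e₂]
  generalize Point.some x₀ y₀ h₀ = P at *
  generalize Point.some x y h = Q at *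
  constructor
  · rintro rfl
    left
    abel
  · rintro (e | e)
    · rw [sub_eq_iff_eq_add] at e
      rw [e]
      abel
    · refine absurd ?_ hne
      rw [sub_eq_iff_eq_add] at e
      rw [e]
      abel

/-- Parametrization of the integral curves with a rational point of order three. -/
lemma exists_parameters {x y : ℚ} (h : (E A B).Nonsingular x y) (hy : y ≠ 0)
    (h3 : 3 • Point.some x y h = 0) :
    ∃ z₁ z₂ : ℤ, A = 27 * z₁ ^ 4 + 6 * z₁ * z₂ ∧ B = z₂ ^ 2 - 27 * z₁ ^ 6 ∧
      x = 3 * z₁ ^ 2 ∧ y = 9 * z₁ ^ 3 + z₂ := by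
  rw [three_nsmul_eq_zero_iff h hy] at h3
  have heq := equation_of_nonsingular h
  obtain ⟨l, hl⟩ : ∃ l, (3 * x ^ 2 + A) / (2 * y) = l := ⟨_, rfl⟩
  rw [hl] at h3
  rw [div_eq_iff (by simpa using hy)] at hl
  have hx : x = l ^ 2 / 3 := by linarith
  subst hx
  have hpoly : l ^ 8 + 18 * A * l ^ 4 + 108 * B * l ^ 2 - 27 * A ^ 2 = 0 := by
    linear_combination (-108) * l ^ 2 * heq - 27 * (3 * (l ^ 2 / 3) ^ 2 + A + l * (2 * y)) * hl
  obtain ⟨m, rfl⟩ : ∃ n : ℤ, (n : ℚ) = l := by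
    refine exists_intCast_of_monic (p := Polynomial.X ^ 8
      + Polynomial.C (18 * A) * Polynomial.X ^ 4
      + Polynomial.C (108 * B) * Polynomial.X ^ 2 - Polynomial.C (27 * A ^ 2)) (by monicity!) ?_
    simpa [map_ofNat] using hpoly
  have hm : (3 : ℤ) ∣ m := by
    apply Int.prime_three.dvd_of_dvd_pow (n := 8)
    refine ⟨-6 * A * m ^ 4 - 36 * B * m ^ 2 + 9 * A ^ 2, ?_⟩
    have : m ^ 8 + 18 * A * m ^ 4 + 108 * B * m ^ 2 - 27 * A ^ 2 = 0 := mod_cast hpoly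
    linear_combination this
  obtain ⟨z, rfl⟩ := hm
  push_cast at *
  obtain ⟨w, rfl⟩ : ∃ n : ℤ, (n : ℚ) = y := by
    apply exists_intCast_of_sq (c := 27 * z ^ 6 + A * (3 * z ^ 2) + B)
    push_cast
    linear_combination heq
  have hA : A = 27 * z ^ 4 + 6 * z * (w - 9 * z ^ 3) := by
    qify
    linear_combination hl
  refine ⟨z, w - 9 * z ^ 3, hA, ?_, by ring, by push_cast; ring⟩
  subst hA
  qify
  push_cast at heq
  linear_combination -heq

lemma divisionPolynomial_eq_zero {z₁ z₂ : ℤ} {x y : ℚ}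
    (hA : A = 27 * z₁ ^ 4 + 6 * z₁ * z₂) (hB : B = z₂ ^ 2 - 27 * z₁ ^ 6)
    (h₀ : (E A B).Nonsingular (3 * z₁ ^ 2) (9 * z₁ ^ 3 + z₂)) (h : (E A B).Nonsingular x y)
    (hx : (3 * z₁ ^ 2 : ℚ) ≠ x) (hy : y ≠ 0)
    (h3 : 3 • Point.some x y h = Point.some _ _ h₀) :
    divisionPolynomial (z₁ : ℚ) z₂ (x - 3 * z₁ ^ 2) = 0 := by
  rw [three_nsmul_eq_iff h₀ h hx hy] at h3
  have heq := equation_of_nonsingular h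
  have hu : x - 3 * z₁ ^ 2 ≠ 0 := sub_ne_zero.mpr hx.symm
  subst hA hB
  push_cast at *
  have hn := norm_eq (z₁ := (z₁ : ℚ)) (z₂ := z₂) (u := x - 3 * z₁ ^ 2) (f := y ^ 2)
    (by rw [heq]; ring) rfl
  refine (mul_eq_zero.mp (hn.symm.trans ?_)).resolve_right (pow_ne_zero 3 hu)
  rw [sub_add_cancel, h3]
  ring

lemma exists_point_of_divisionPolynomial {z₁ z₂ : ℤ} {u : ℚ}
    (hΔ : 4 * A ^ 3 + 27 * B ^ 2 ≠ 0)
    (hA : A = 27 * z₁ ^ 4 + 6 * z₁ * z₂) (hB : B = z₂ ^ 2 - 27 * z₁ ^ 6)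
    (h₀ : (E A B).Nonsingular (3 * z₁ ^ 2) (9 * z₁ ^ 3 + z₂)) (hw : (9 * z₁ ^ 3 + z₂ : ℚ) ≠ 0)
    (hu : divisionPolynomial (z₁ : ℚ) z₂ u = 0) :
    ∃ Q : (E A B).Point, 3 • Q = Point.some _ _ h₀ := by
  have hu0 : u ≠ 0 := by
    rintro rfl
    simp [divisionPolynomial, hw] at hu
  obtain ⟨f, hf⟩ : ∃ f : ℚ, f = (u + 3 * z₁ ^ 2) ^ 3
    + (27 * z₁ ^ 4 + 6 * z₁ * z₂) * (u + 3 * z₁ ^ 2) + (z₂ ^ 2 - 27 * z₁ ^ 6) := ⟨_, rfl⟩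
  obtain ⟨k, hk⟩ : ∃ k : ℚ, k = 3 * (u + 3 * z₁ ^ 2) ^ 2 + (27 * z₁ ^ 4 + 6 * z₁ * z₂) :=
    ⟨_, rfl⟩
  have hn := norm_eq hf hk
  rw [hu, zero_mul, sub_eq_zero] at hn
  have hAq : (A : ℚ) = 27 * z₁ ^ 4 + 6 * z₁ * z₂ := by simp [hA]
  have hBq : (B : ℚ) = z₂ ^ 2 - 27 * z₁ ^ 6 := by simp [hB]
  have hf0 : f ≠ 0 := by
    rintro rfl
    have hk0 : k = 0 := by simpa [hu0] using hn
    have h := (nonsingular_E_iff hΔ (u + 3 * z₁ ^ 2) 0).mpr (by rw [hAq, hBq, ← hf]; norm_num)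
    rw [nonsingular_iff] at h
    simp [E, hAq, ← hk, hk0] at h
  obtain ⟨y, hy⟩ : ∃ y, y = (k ^ 2 * u ^ 2 - 4 * f * (f + (9 * z₁ ^ 3 + z₂) ^ 2 + u ^ 3)) /
    (8 * f * (9 * z₁ ^ 3 + z₂)) := ⟨_, rfl⟩
  have hyf : y ^ 2 = f := by
    rw [hy, div_pow, hn, div_eq_iff (pow_ne_zero 2 (by simp [hf0, hw]))]
    ring
  have hy0 : y ≠ 0 := by
    rintro rfl
    exact hf0 (by simpa using hyf.symm)
  have h := (nonsingular_E_iff hΔ (u + 3 * z₁ ^ 2) y).mpr (by rw [hyf, hf, hAq, hBq])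
  have hx : (3 * z₁ ^ 2 : ℚ) ≠ u + 3 * z₁ ^ 2 := by simpa using hu0
  refine ⟨Point.some _ _ h, ?_⟩
  rw [three_nsmul_eq_iff h₀ h hx hy0, hAq, ← hk]
  rw [eq_div_iff (by simp [hf0, hw])] at hy
  rw [add_sub_cancel_right, hyf, ← hy, ← hyf]
  ring

end OrderNine

open OrderNine

theorem order_nine_iff (A B : ℤ) (hΔ : 4 * A ^ 3 + 27 * B ^ 2 ≠ 0) :
    (∃ P : (E A B).Point, addOrderOf P = 9) ↔
      ∃ z₁ z₂ z₃ : ℤ,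
        A = 27 * z₁ ^ 4 + 6 * z₁ * z₂ ∧
        B = z₂ ^ 2 - 27 * z₁ ^ 6 ∧
        z₃ ^ 9 - 72 * z₁ * (9 * z₁ ^ 3 + z₂) * z₃ ^ 7
          - 48 * (27 * z₁ ^ 3 + 2 * z₂) * (9 * z₁ ^ 3 + z₂) * z₃ ^ 6
          - 864 * z₁ ^ 2 * (9 * z₁ ^ 3 + z₂) ^ 2 * z₃ ^ 5
          - 144 * z₁ * (9 * z₁ ^ 3 + z₂) ^ 3 * z₃ ^ 4
          + 48 * (45 * z₁ ^ 3 + z₂) * (9 * z₁ ^ 3 + z₂) ^ 3 * z₃ ^ 3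
          + 1728 * z₁ ^ 2 * (9 * z₁ ^ 3 + z₂) ^ 4 * z₃ ^ 2
          + 576 * z₁ * (9 * z₁ ^ 3 + z₂) ^ 5 * z₃
          + 64 * (9 * z₁ ^ 3 + z₂) ^ 6 = 0 := by
  constructor
  · rintro ⟨Q, hQ⟩
    have hsmul (n : ℕ) (hn : ¬ 9 ∣ n) : n • Q ≠ 0 := by
      rwa [Ne, ← addOrderOf_dvd_iff_nsmul_eq_zero, hQ]
    have h9 : 3 • 3 • Q = 0 := by
      rw [← mul_nsmul]
      exact addOrderOf_dvd_iff_nsmul_eq_zero.mp (by rw [hQ])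
    obtain ⟨P, hP⟩ : ∃ P, 3 • Q = P := ⟨_, rfl⟩
    rcases Q with _ | ⟨x, y, h⟩
    · exact absurd (nsmul_zero 1 : 1 • (0 : (E A B).Point) = 0) (hsmul 1 (by norm_num))
    rcases P with _ | ⟨x₀, y₀, h₀⟩
    · exact absurd hP (hsmul 3 (by norm_num))
    have hy : y ≠ 0 := fun h0 => hsmul 2 (by norm_num) (by
      rw [two_nsmul, add_self_eq_zero h h0])
    have hy₀ : y₀ ≠ 0 := fun h0 => hsmul 6 (by norm_num) (by
      rw [show 6 = 3 * 2 from rfl, mul_nsmul, hP, two_nsmul, add_self_eq_zero h₀ h0])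
    have hx : x₀ ≠ x := by
      intro hx
      rw [WeierstrassCurve.Affine.Point.X_eq_iff (h₁ := h₀) (h₂ := h), ← hP] at hx
      rcases hx with hx | hx
      · refine hsmul 2 (by norm_num) ?_
        rwa [succ_nsmul, add_eq_right] at hx
      · refine hsmul 4 (by norm_num) ?_
        rw [succ_nsmul, hx, neg_add_cancel]
    rw [hP] at h9
    obtain ⟨z₁, z₂, hA, hB, rfl, rfl⟩ := exists_parameters h₀ hy₀ h9
    have hd := divisionPolynomial_eq_zero hA hB h₀ h hx hy hP
    obtain ⟨z₃, hz₃⟩ := exists_intCast_of_divisionPolynomial hd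
    rw [← hz₃] at hd
    refine ⟨z₁, z₂, z₃, hA, hB, ?_⟩
    unfold divisionPolynomial at hd
    exact_mod_cast hd
  · rintro ⟨z₁, z₂, z₃, hA, hB, hz⟩
    have hw : (9 * z₁ ^ 3 + z₂ : ℚ) ≠ 0 := by
      intro hw
      have hw' : 9 * z₁ ^ 3 + z₂ = 0 := mod_cast hw
      apply hΔ
      rw [hA, hB, eq_neg_of_add_eq_zero_right hw']
      ring
    have h₀ : (E A B).Nonsingular (3 * z₁ ^ 2) (9 * z₁ ^ 3 + z₂) := by
      rw [nonsingular_E_iff hΔ, hA, hB]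
      push_cast
      ring
    have h3 : 3 • WeierstrassCurve.Affine.Point.some _ _ h₀ = 0 := by
      rw [three_nsmul_eq_zero_iff h₀ hw, hA, div_pow, div_eq_iff (by simp [hw])]
      push_cast
      ring
    obtain ⟨Q, hQ⟩ := exists_point_of_divisionPolynomial (u := z₃) hΔ hA hB h₀ hw
      (by unfold divisionPolynomial; exact_mod_cast hz)
    refine ⟨Q, addOrderOf_eq_prime_pow (p := 3) (n := 1) ?_ ?_⟩
    · rw [pow_one, hQ]
      exact WeierstrassCurve.Affine.Point.some_ne_zero h₀
    · rw [pow_succ, pow_one, mul_nsmul, hQ, h3]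
end
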